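/- arXiv:1407.7582 — 5 statements merged into one kernel-verified Lean document; each statement's English description precedes it below -/
import Mathlib

section
/- Let $Y$ and $Z$ be finite sets with $|Y| = k$ and $|Z| = m$, and let $n \le m$ be a natural number. Then there exists a spread $f : Y \to \binom{Z}{n}$ (i.e., an injective map $f$ from $Y$ to the $n$-element subsets of $Z$ such that $\bigcup_{y \in Y} f(y) = Z$ and $\bigcap_{y \in Y} f(y) = \varnothing$) if and only if the following three conditions hold: (1) $\binom{m}{n} \ge k$; (2) $n k \ge m$; (3) $(k-1) m \ge n k$. -/
open Finset

/-- The number of members of `F` containing `z`. -/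
def setDegree {α : Type*} [DecidableEq α] (F : Finset (Finset α)) (z : α) : ℕ :=
  #{S ∈ F | z ∈ S}

section SetDegree

variable {α : Type*} [DecidableEq α]

theorem setDegree_eq_sum (F : Finset (Finset α)) (z : α) :
    setDegree F z = ∑ S ∈ F, if z ∈ S then 1 else 0 :=
  card_filter _ _

theorem sum_setDegree {F : Finset (Finset α)} {Z : Finset α} {n : ℕ}
    (hF : F ⊆ Z.powersetCard n) : ∑ z ∈ Z, setDegree F z = n * #F := by
  simp only [setDegree_eq_sum]
  rw [sum_comm, mul_comm, ← smul_eq_mul, ← sum_const]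
  refine sum_congr rfl fun S hS => ?_
  obtain ⟨hSZ, hSn⟩ := mem_powersetCard.1 (hF hS)
  rw [← card_filter, filter_mem_eq_inter, inter_eq_right.2 hSZ, hSn]

/-- Replacing a member `S` of `F` by a new set `T` changes degrees by the difference of
indicators. -/
theorem setDegree_replace {F : Finset (Finset α)} {S T : Finset α} (hS : S ∈ F) (hT : T ∉ F)
    (z : α) :
    setDegree (insert T (F.erase S)) z + (if z ∈ S then 1 else 0) =
      setDegree F z + (if z ∈ T then 1 else 0) := by
  rw [setDegree_eq_sum, setDegree_eq_sum, sum_insert (fun h => hT (mem_of_mem_erase h)),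
    ← add_sum_erase F _ hS]
  ring

/-- If `a` has larger degree than `b`, some member of `F` can have `a` exchanged for `b`
producing a set outside `F`. -/
theorem exists_exchange {F : Finset (Finset α)} {a b : α}
    (h : setDegree F b < setDegree F a) :
    ∃ S ∈ F, a ∈ S ∧ b ∉ S ∧ insert b (S.erase a) ∉ F := by
  by_contra! hcon
  refine h.not_ge ?_
  have key : #{S ∈ F | a ∈ S ∧ b ∉ S} ≤ #{S ∈ F | b ∈ S ∧ a ∉ S} := by
    refine card_le_card_of_injOn (fun S => insert b (S.erase a)) ?_ ?_
    · intro S hS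
      simp only [coe_filter, Set.mem_ofPred_eq] at hS ⊢
      obtain ⟨hSF, ha, hb⟩ := hS
      have hab : a ≠ b := fun e => hb (e ▸ ha)
      exact ⟨hcon S hSF ha hb, by simp, by simp [hab]⟩
    · intro S hS T hT hST
      simp only [coe_filter, Set.mem_ofPred_eq] at hS hT
      ext x
      have := congrArg (x ∈ ·) hST
      simp only [mem_insert, mem_erase, eq_iff_iff] at this
      grind
  have split (u v : α) : setDegree F u =
      #{S ∈ F | u ∈ S ∧ v ∈ S} + #{S ∈ F | u ∈ S ∧ v ∉ S} := by
    rw [setDegree, ← card_filter_add_card_filter_not (fun S => v ∈ S), filter_filter,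
      filter_filter]
  rw [split a b, split b a]
  simp only [and_comm (a := b ∈ _) (b := a ∈ _)] at key ⊢
  omega

/-- There are families of `k` distinct `n`-subsets of `Z` whose degrees differ by at most one. -/
theorem exists_balanced_family (Z : Finset α) {k n : ℕ} (hk : k ≤ (#Z).choose n) :
    ∃ F ⊆ Z.powersetCard n, #F = k ∧
      ∀ a ∈ Z, ∀ b ∈ Z, setDegree F a ≤ setDegree F b + 1 := by
  have hne : ((Z.powersetCard n).powersetCard k).Nonempty := by
    rw [powersetCard_nonempty, card_powersetCard]
    exact hk
  obtain ⟨F, hF, hmin⟩ := exists_min_image _ (fun F => ∑ z ∈ Z, setDegree F z ^ 2) hne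
  obtain ⟨hFZ, hFk⟩ := mem_powersetCard.1 hF
  refine ⟨F, hFZ, hFk, fun a ha b hb => ?_⟩
  by_contra! hlt
  obtain ⟨S, hS, haS, hbS, hT⟩ := exists_exchange (F := F) (a := a) (b := b) (by omega)
  have hab : a ≠ b := fun e => hbS (e ▸ haS)
  obtain ⟨hSZ, hSn⟩ := mem_powersetCard.1 (hFZ hS)
  have hdeg := setDegree_replace hS hT
  have hF' : insert (insert b (S.erase a)) (F.erase S) ∈ (Z.powersetCard n).powersetCard k := by
    refine mem_powersetCard.2 ⟨insert_subset (mem_powersetCard.2 ⟨?_, ?_⟩)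
      ((erase_subset _ _).trans hFZ), ?_⟩
    · exact insert_subset hb ((erase_subset _ _).trans hSZ)
    · rw [card_insert_of_notMem (fun h => hbS (mem_of_mem_erase h)),
        card_erase_add_one haS, hSn]
    · rw [card_insert_of_notMem (fun h => hT (mem_of_mem_erase h)),
        card_erase_add_one hS, hFk]
  have hle := hmin _ hF'
  have hb' : b ∈ Z.erase a := mem_erase.2 ⟨hab.symm, hb⟩
  rw [← add_sum_erase Z _ ha, ← add_sum_erase Z _ ha, ← add_sum_erase _ _ hb',
    ← add_sum_erase _ _ hb'] at hle
  have hrest : ∀ z ∈ (Z.erase a).erase b,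
      setDegree (insert (insert b (S.erase a)) (F.erase S)) z ^ 2 = setDegree F z ^ 2 := by
    intro z hz
    have hzb := ne_of_mem_erase hz
    have hza := ne_of_mem_erase (mem_of_mem_erase hz)
    have := hdeg z
    simp only [mem_insert, mem_erase, hzb, hza, ne_eq, not_false_eq_true, true_and,
      false_or] at this
    rw [Nat.add_right_cancel this]
  rw [sum_congr rfl hrest] at hle
  have hda := hdeg a
  have hdb := hdeg b
  simp only [haS, hbS, hab, mem_insert, mem_erase, ne_eq, not_true_eq_false, false_and,
    or_false, true_or, if_true, if_false, add_zero] at hda hdb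
  rw [← hda, hdb] at hle
  rw [← hda] at hlt
  nlinarith

end SetDegree

/-- **Spread existence criterion.**
Let `Y` and `Z` be finite sets with `|Y| = k` and `|Z| = m`, and let `n ≤ m`.
A *spread* is an injective map `f` from `Y` to the `n`-element subsets of `Z`
such that `⋃_{y ∈ Y} f y = Z` (coverage) and `⋂_{y ∈ Y} f y = ∅` (avoidance).
Such a spread exists iff `C(m,n) ≥ k`, `n·k ≥ m` and `(k-1)·m ≥ n·k`. -/
theorem spread_exists_iff {α β : Type*} [DecidableEq α] [DecidableEq β]
    (Y : Finset β) (Z : Finset α) (k m n : ℕ)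
    (hY : Y.card = k) (hZ : Z.card = m) (hnm : n ≤ m) :
    (∃ f : β → Finset α,
        Set.InjOn f ↑Y ∧
        (∀ y ∈ Y, f y ∈ Z.powersetCard n) ∧
        Y.biUnion f = Z ∧
        (∀ z ∈ Z, ∃ y ∈ Y, z ∉ f y)) ↔
      (m.choose n ≥ k ∧ n * k ≥ m ∧ (k - 1) * m ≥ n * k) := by
  subst hY hZ
  constructor
  · rintro ⟨f, hinj, hf, hcov, havoid⟩
    have hsub : Y.image f ⊆ Z.powersetCard n := image_subset_iff.2 hf
    have hcard : #(Y.image f) = #Y := card_image_of_injOn hinj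
    refine ⟨?_, ?_, ?_⟩
    · rw [← card_powersetCard, ← hcard]
      exact card_le_card hsub
    · rw [← hcov, mul_comm]
      exact card_biUnion_le_card_mul _ _ _ fun y hy => (mem_powersetCard.1 (hf y hy)).2.le
    · rw [← hcard, ← sum_setDegree hsub, mul_comm, ← smul_eq_mul]
      refine sum_le_card_nsmul _ _ _ fun z hz => Nat.le_sub_one_of_lt ?_
      obtain ⟨y, hy, hzy⟩ := havoid z hz
      exact card_lt_card (filter_ssubset.2 ⟨f y, mem_image_of_mem f hy, hzy⟩)
  · rintro ⟨hchoose, hcov, havoid⟩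
    obtain ⟨F, hFZ, hFk, hbal⟩ := exists_balanced_family Z hchoose
    have hsum := sum_setDegree hFZ
    rw [hFk] at hsum
    obtain ⟨f, hf⟩ : ∃ f : β → Finset α, Set.BijOn f ↑Y ↑F :=
      Y.finite_toSet.exists_bijOn_of_encard_eq (by simp [hFk])
    refine ⟨f, hf.injOn, fun y hy => hFZ (hf.mapsTo hy), ?_, fun z hz => ?_⟩
    · refine Subset.antisymm
        (biUnion_subset.2 fun y hy => (mem_powersetCard.1 (hFZ (hf.mapsTo hy))).1) fun z hz => ?_
      by_contra hzf
      have hz0 : setDegree F z = 0 := by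
        refine card_eq_zero.2 (filter_eq_empty_iff.2 fun S hS hzS => hzf ?_)
        obtain ⟨y, hy, rfl⟩ := hf.surjOn hS
        exact mem_biUnion.2 ⟨y, hy, hzS⟩
      have hlt : ∑ x ∈ Z, setDegree F x < ∑ x ∈ Z, 1 :=
        sum_lt_sum (fun x hx => by have := hbal x hx z hz; omega) ⟨z, hz, by omega⟩
      rw [hsum, ← card_eq_sum_ones] at hlt
      omega
    · by_contra! hzf
      have hzk : setDegree F z = #Y := by
        rw [← hFk]
        refine congrArg card (filter_true_of_mem fun S hS => ?_)
        obtain ⟨y, hy, rfl⟩ := hf.surjOn hS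
        exact hzf y hy
      have hpos : 0 < #Y := by
        have := card_pos.2 ⟨z, hz⟩
        exact Nat.pos_of_mul_pos_left (this.trans_le hcov)
      have hlt : ∑ x ∈ Z, (#Y - 1) < ∑ x ∈ Z, setDegree F x :=
        sum_lt_sum (fun x hx => by have := hbal z hz x hx; omega) ⟨z, hz, by omega⟩
      rw [hsum, sum_const, smul_eq_mul, mul_comm] at hlt
      omega
end

section
/- Let $a, b \ge 1$ be natural numbers, let $\mathrm{Deck}$ be a finite set with $a + b$ elements, and let $k > 1$ be an integer such that $k \le \binom{a+b}{a}$ and $a \le b \le (k-1)a$. Then there exist $k$ pairwise distinct subsets $A_1, \ldots, A_k$ of $\mathrm{Deck}$, each of cardinality $a$, such that $\bigcup_{i=1}^{k} A_i = \mathrm{Deck}$ and $\bigcap_{i=1}^{k} A_i = \varnothing$. -/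
/-- If `S ⊆ T`, `#S ≤ m * a` and `a ≤ #T`, then `S` is covered by at most `m` subsets of `T`
of cardinality `a`. -/
theorem exists_cover_powersetCard {α : Type*} [DecidableEq α] (a : ℕ) (T : Finset α)
    (haT : a ≤ T.card) (m : ℕ) :
    ∀ S ⊆ T, S.card ≤ m * a →
      ∃ F ⊆ T.powersetCard a, F.card ≤ m ∧ ∀ c ∈ S, ∃ B ∈ F, c ∈ B := by
  induction m with
  | zero =>
    intro S _ hS
    have hS' : S = ∅ := by simpa using hS
    exact ⟨∅, by simp, by simp, by simp [hS']⟩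
  | succ m ih =>
    intro S hST hS
    obtain ⟨B, hBT, hBa, hSB⟩ :
        ∃ B ⊆ T, B.card = a ∧ (S \ B).card ≤ m * a := by
      rcases le_total S.card a with h | h
      · obtain ⟨B, hSB, hBT, hB⟩ := Finset.exists_subsuperset_card_eq hST h haT
        exact ⟨B, hBT, hB, by simp [Finset.sdiff_eq_empty_iff_subset.mpr hSB]⟩
      · obtain ⟨B, hBS, hB⟩ := Finset.exists_subset_card_eq h
        refine ⟨B, hBS.trans hST, hB, ?_⟩
        rw [Finset.card_sdiff_of_subset hBS, hB]
        rw [Nat.succ_mul] at hS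
        omega
    obtain ⟨F, hF, hFm, hcov⟩ := ih (S \ B) (Finset.sdiff_subset.trans hST) hSB
    refine ⟨insert B F, ?_, (Finset.card_insert_le _ _).trans (by omega), fun c hc => ?_⟩
    · exact Finset.insert_subset (Finset.mem_powersetCard.mpr ⟨hBT, hBa⟩) hF
    · by_cases hcB : c ∈ B
      · exact ⟨B, Finset.mem_insert_self _ _, hcB⟩
      · obtain ⟨C, hC, hcC⟩ := hcov c (Finset.mem_sdiff.mpr ⟨hc, hcB⟩)
        exact ⟨C, Finset.mem_insert_of_mem hC, hcC⟩

/-- **Existence of a `k`-diffusion in the two-agent case.**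
Let `a, b ≥ 1`, let `Deck` have `a + b` elements, and let `k > 1` satisfy
`k ≤ C(a+b, a)` and `a ≤ b ≤ (k-1)·a`. Then there are `k` pairwise distinct
`a`-element subsets of `Deck` whose union is `Deck` and whose intersection is empty. -/
theorem two_agent_diffusion_exists {α : Type*} [DecidableEq α]
    (a b k : ℕ) (ha : 1 ≤ a) (hb : 1 ≤ b)
    (Deck : Finset α) (hDeck : Deck.card = a + b)
    (hk : 1 < k) (hkle : k ≤ (a + b).choose a)
    (hab : a ≤ b) (hbk : b ≤ (k - 1) * a) :
    ∃ A : Fin k → Finset α,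
      Function.Injective A ∧
      (∀ i, A i ⊆ Deck) ∧
      (∀ i, (A i).card = a) ∧
      Finset.univ.biUnion A = Deck ∧
      (∀ c ∈ Deck, ∃ i, c ∉ A i) := by
  obtain ⟨H, hHD, hH⟩ := Finset.exists_subset_card_eq (s := Deck) (n := a) (by omega)
  have hS : (Deck \ H).card = b := by
    rw [Finset.card_sdiff_of_subset hHD]
    omega
  obtain ⟨F, hF, hFk, hcov⟩ := exists_cover_powersetCard a (Deck \ H) (by omega) (k - 1)
    (Deck \ H) subset_rfl (by omega)
  have hHF : insert H F ⊆ Deck.powersetCard a :=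
    Finset.insert_subset (Finset.mem_powersetCard.mpr ⟨hHD, hH⟩)
      (hF.trans (Finset.powersetCard_mono Finset.sdiff_subset))
  obtain ⟨G, hHG, hGD, hG⟩ := Finset.exists_subsuperset_card_eq hHF (n := k)
    ((Finset.card_insert_le _ _).trans (by omega))
    (by rwa [Finset.card_powersetCard, hDeck])
  let e := (Finset.equivFinOfCardEq hG).symm
  have hmem (i : Fin k) : (e i : Finset α) ⊆ Deck ∧ (e i : Finset α).card = a :=
    Finset.mem_powersetCard.mp (hGD (e i).2)
  have hidx {B : Finset α} (hB : B ∈ insert H F) : ∃ i, (e i : Finset α) = B :=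
    ⟨e.symm ⟨B, hHG hB⟩, by simp⟩
  refine ⟨fun i => e i, Subtype.val_injective.comp e.injective, fun i => (hmem i).1,
    fun i => (hmem i).2, ?_, fun c hc => ?_⟩
  · refine subset_antisymm (Finset.biUnion_subset.mpr fun i _ => (hmem i).1) fun c hc => ?_
    obtain ⟨B, hB, hcB⟩ : ∃ B ∈ insert H F, c ∈ B := by
      by_cases hcH : c ∈ H
      · exact ⟨H, Finset.mem_insert_self _ _, hcH⟩
      · obtain ⟨B, hB, hcB⟩ := hcov c (Finset.mem_sdiff.mpr ⟨hc, hcH⟩)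
        exact ⟨B, Finset.mem_insert_of_mem hB, hcB⟩
    obtain ⟨i, hi⟩ := hidx hB
    exact Finset.mem_biUnion.mpr ⟨i, Finset.mem_univ i, hi ▸ hcB⟩
  · obtain ⟨B, hB, hcB⟩ : ∃ B ∈ insert H F, c ∉ B := by
      by_cases hcH : c ∈ H
      · obtain ⟨d, hd⟩ := Finset.card_pos.mp (hS ▸ hb)
        obtain ⟨B, hB, -⟩ := hcov d hd
        refine ⟨B, Finset.mem_insert_of_mem hB, fun hcB => ?_⟩
        exact (Finset.mem_sdiff.mp ((Finset.mem_powersetCard.mp (hF hB)).1 hcB)).2 hcH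
      · exact ⟨H, Finset.mem_insert_self _ _, hcH⟩
    obtain ⟨i, hi⟩ := hidx hB
    exact ⟨i, by simpa only [hi] using hcB⟩
end

section
/- Let $\mathcal{P}$ be a finite set of agents and let $T$ and $R$ be disjoint finite decks. Let $\Gamma$ be a $k$-diffusion of deals over $T$ and $\Delta$ be a $k$-diffusion of deals over $R$, and let $f : \Gamma \to \Delta$ be a bijection. Then the fusion $\Gamma \oplus_f \Delta = \{ G \oplus f(G) : G \in \Gamma \}$ is a $k$-diffusion of deals over $T \cup R$. -/
/-- A deal over a deck: a family of pairwise disjoint hands whose union is the deck. -/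
def IsDeal {A C : Type*} [DecidableEq C] (Deck : Finset C) (H : A → Finset C) : Prop :=
  (∀ Q Q' : A, Q ≠ Q' → Disjoint (H Q) (H Q')) ∧
  (∀ Q : A, H Q ⊆ Deck) ∧
  (∀ c ∈ Deck, ∃ Q : A, c ∈ H Q)

/-- A `k`-diffusion over a deck `D`: a set of `k` deals over `D` such that distinct
deals differ in every agent's hand, and every card of `D` is held by some agent in
one deal but not held by that agent in another deal. -/
def IsDiffusion {A C : Type*} [DecidableEq C] (D : Finset C) (k : ℕ)
    (Δ : Set (A → Finset C)) : Prop :=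
  Δ.ncard = k ∧
  (∀ H ∈ Δ, IsDeal D H) ∧
  (∀ H ∈ Δ, ∀ H' ∈ Δ, H ≠ H' → ∀ Q : A, H Q ≠ H' Q) ∧
  (∀ c ∈ D, ∃ H ∈ Δ, ∃ H' ∈ Δ, ∃ Q : A, c ∈ H Q ∧ c ∉ H' Q)

/-- Intersecting a fused hand with the first deck recovers the first hand. -/
lemma union_inter_eq_left_of_disjoint {C : Type*} [DecidableEq C] {T R a b : Finset C}
    (hTR : Disjoint T R) (ha : a ⊆ T) (hb : b ⊆ R) : (a ∪ b) ∩ T = a := by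
  rw [Finset.union_inter_distrib_right, Finset.inter_eq_left.mpr ha,
    Finset.disjoint_iff_inter_eq_empty.mp (hTR.symm.mono_left hb), Finset.union_empty]

/-- The fusion of deals over disjoint decks is a deal over the union of the decks. -/
lemma IsDeal.union {A C : Type*} [DecidableEq C] {T R : Finset C} (hTR : Disjoint T R)
    {G H : A → Finset C} (hG : IsDeal T G) (hH : IsDeal R H) :
    IsDeal (T ∪ R) (fun Q => G Q ∪ H Q) := by
  obtain ⟨hGdisj, hGsub, hGcover⟩ := hG
  obtain ⟨hHdisj, hHsub, hHcover⟩ := hH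
  refine ⟨fun Q Q' hQ => ?_, fun Q => Finset.union_subset_union (hGsub Q) (hHsub Q),
    fun c hc => ?_⟩
  · simp only [Finset.disjoint_union_left, Finset.disjoint_union_right]
    exact ⟨⟨hGdisj Q Q' hQ, hTR.symm.mono (hHsub Q) (hGsub Q')⟩,
      hTR.mono (hGsub Q) (hHsub Q'), hHdisj Q Q' hQ⟩
  · rcases Finset.mem_union.mp hc with hc | hc
    · obtain ⟨Q, hQ⟩ := hGcover c hc
      exact ⟨Q, Finset.mem_union_left _ hQ⟩
    · obtain ⟨Q, hQ⟩ := hHcover c hc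
      exact ⟨Q, Finset.mem_union_right _ hQ⟩

/-- **Fusion of diffusions through a spread is a diffusion.**
If `T` and `R` are disjoint decks, `Γ` is a `k`-diffusion over `T`, `Δ` is a
`k`-diffusion over `R`, and `f : Γ → Δ` is a bijection, then the fusion
`Γ ⊕_f Δ = { G ⊕ f(G) : G ∈ Γ }` (where `(G ⊕ D)_Q = G_Q ∪ D_Q`) is a
`k`-diffusion over `T ∪ R`. -/
theorem fusion_isDiffusion {A C : Type*} [DecidableEq C]
    (T R : Finset C) (hTR : Disjoint T R) (k : ℕ)
    (Γ Δ : Set (A → Finset C)) (f : (A → Finset C) → (A → Finset C))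
    (hΓ : IsDiffusion T k Γ) (hΔ : IsDiffusion R k Δ)
    (hf : Set.BijOn f Γ Δ) :
    IsDiffusion (T ∪ R) k ((fun G => fun Q => G Q ∪ f G Q) '' Γ) := by
  obtain ⟨hΓcard, hΓdeal, hΓdiff, hΓmoves⟩ := hΓ
  obtain ⟨-, hΔdeal, -, hΔmoves⟩ := hΔ
  have left_hand : ∀ G ∈ Γ, ∀ Q, (G Q ∪ f G Q) ∩ T = G Q := fun G hG Q =>
    union_inter_eq_left_of_disjoint hTR ((hΓdeal G hG).2.1 Q)
      ((hΔdeal _ (hf.mapsTo hG)).2.1 Q)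
  have hand_inj : ∀ G ∈ Γ, ∀ G' ∈ Γ, ∀ Q, G Q ∪ f G Q = G' Q ∪ f G' Q → G Q = G' Q :=
    fun G hG G' hG' Q h => by rw [← left_hand G hG Q, h, left_hand G' hG' Q]
  refine ⟨?_, ?_, ?_, ?_⟩
  · rw [Set.InjOn.ncard_image, hΓcard]
    exact fun G hG G' hG' h => funext fun Q => hand_inj G hG G' hG' Q (congrFun h Q)
  · rintro _ ⟨G, hG, rfl⟩
    exact IsDeal.union hTR (hΓdeal G hG) (hΔdeal _ (hf.mapsTo hG))
  · rintro _ ⟨G, hG, rfl⟩ _ ⟨G', hG', rfl⟩ hne Q h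
    refine hΓdiff G hG G' hG' ?_ Q (hand_inj G hG G' hG' Q h)
    rintro rfl
    exact hne rfl
  · intro c hc
    rcases Finset.mem_union.mp hc with hc | hc
    · obtain ⟨G, hG, G', hG', Q, hmem, hnot⟩ := hΓmoves c hc
      refine ⟨_, ⟨G, hG, rfl⟩, _, ⟨G', hG', rfl⟩, Q, Finset.mem_union_left _ hmem, fun h => ?_⟩
      refine (Finset.mem_union.mp h).elim hnot fun h => ?_
      exact Finset.disjoint_left.mp hTR hc ((hΔdeal _ (hf.mapsTo hG')).2.1 Q h)
    · obtain ⟨H, hH, H', hH', Q, hmem, hnot⟩ := hΔmoves c hc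
      obtain ⟨G, hG, rfl⟩ := hf.surjOn hH
      obtain ⟨G', hG', rfl⟩ := hf.surjOn hH'
      refine ⟨_, ⟨G, hG, rfl⟩, _, ⟨G', hG', rfl⟩, Q, Finset.mem_union_right _ hmem, fun h => ?_⟩
      refine (Finset.mem_union.mp h).elim (fun h => ?_) hnot
      exact Finset.disjoint_left.mp hTR ((hΓdeal G' hG').2.1 Q h) hc
end

section
/- Let $X$ be a finite set with $n$ elements and let $a < n$ and $k > 2$ be natural numbers such that $n \ge k^2$ and $(k-1)(n-k) \le k a \le (k-1) n$. Then there exist subsets $Y_1, \ldots, Y_k$ of $X$ such that: (1) $|Y_i| = n - a$ for all $i \le k$; (2) $Y_{j_1} \cap Y_{j_2} \cap Y_{j_3} = \varnothing$ whenever $j_1, j_2, j_3$ are pairwise distinct; (3) $\bigcup_{i=1}^{k} Y_i = X$; and (4) $|Y_i \cap Y_j| \le 2$ whenever $i \ne j$. -/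
open Finset in
/-- Labellings of a finite set with prescribed fibre sizes. -/
theorem exists_label_card_fiber_eq {α ι : Type*} [DecidableEq α] [Fintype ι] [DecidableEq ι]
    [Nonempty ι] (T : Finset α) (c : ι → ℕ) (hT : #T = ∑ i, c i) :
    ∃ f : α → ι, ∀ i, #{x ∈ T | f x = i} = c i := by
  classical
  have hcard : Fintype.card T = Fintype.card (Σ i, Fin (c i)) := by simp [hT]
  let e : T ≃ Σ i, Fin (c i) := Fintype.equivOfCardEq hcard
  refine ⟨fun x => if h : x ∈ T then (e ⟨x, h⟩).1 else Classical.arbitrary ι, fun i => ?_⟩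
  have himage : {x ∈ T | (if h : x ∈ T then (e ⟨x, h⟩).1 else Classical.arbitrary ι) = i} =
      (univ : Finset (Fin (c i))).image fun r => (e.symm ⟨i, r⟩ : α) := by
    ext x
    simp only [mem_filter, mem_image, mem_univ, true_and]
    constructor
    · rintro ⟨hx, h⟩
      rw [dif_pos hx] at h
      subst h
      exact ⟨(e ⟨x, hx⟩).2, by simp⟩
    · rintro ⟨r, rfl⟩
      simp
  rw [himage, card_image_of_injective _ fun r s h => ?_, card_univ, Fintype.card_fin]
  simpa using e.symm.injective (Subtype.ext h)

/-- A number is determined by its quotient by `k` and by a shift of it, by an amount depending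
only on that quotient, modulo `k`. -/
theorem Nat.eq_of_div_eq_of_add_mod_eq {k s t : ℕ} (u : ℕ) (hdiv : s / k = t / k)
    (hmod : (s + u) % k = (t + u) % k) : s = t := by
  have h : s % k = t % k := Nat.ModEq.add_right_cancel' u hmod
  rw [← Nat.div_add_mod s k, ← Nat.div_add_mod t k, hdiv, h]

open Finset in
/-- At most `k * (k - 1)` points can be labelled by distinct ordered pairs of distinct elements of
`Fin k` in a balanced way: every coordinate takes each value at most `c` times, as soon as there
are at most `k * c` points. -/
theorem exists_balanced_pair_labels {α : Type*} [DecidableEq α] (S : Finset α) {k c : ℕ}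
    (hk : 0 < k) (hck : c < k) (hS : #S ≤ k * c) :
    ∃ p q : α → Fin k, (∀ x ∈ S, p x ≠ q x) ∧
      (∀ x ∈ S, ∀ y ∈ S, p x = p y → q x = q y → x = y) ∧
      (∀ i, #{x ∈ S | p x = i} ≤ c) ∧ ∀ i, #{x ∈ S | q x = i} ≤ c := by
  classical
  let g : α → ℕ := fun x => if h : x ∈ S then S.equivFin ⟨x, h⟩ else 0
  have hg_div : ∀ x ∈ S, g x / k < c := fun x hx => by
    refine Nat.div_lt_of_lt_mul (lt_of_lt_of_le ?_ hS)
    simp [g, hx]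
  have hg_inj : ∀ x ∈ S, ∀ y ∈ S, g x = g y → x = y := fun x hx y hy h => by
    simpa [g, hx, hy, Fin.val_inj] using h
  refine ⟨fun x => ⟨g x % k, Nat.mod_lt _ hk⟩,
    fun x => ⟨(g x + (1 + g x / k)) % k, Nat.mod_lt _ hk⟩, ?_, ?_, fun i => ?_, fun i => ?_⟩
  · intro x hx h
    have hmod : g x + 0 ≡ g x + (1 + g x / k) [MOD k] := Fin.val_eq_of_eq h
    have hzero := Nat.ModEq.add_left_cancel' _ hmod
    have hlt := hg_div x hx
    rw [Nat.ModEq, Nat.zero_mod, Nat.mod_eq_of_lt (by omega)] at hzero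
    exact absurd hzero (by positivity : 0 < 1 + g x / k).ne
  · intro x hx y hy hp hq
    replace hp : g x ≡ g y [MOD k] := Fin.val_eq_of_eq hp
    replace hq : g x + (1 + g x / k) ≡ g y + (1 + g y / k) [MOD k] := Fin.val_eq_of_eq hq
    have hdiv := Nat.ModEq.add_left_cancel hp hq
    have hx' := hg_div x hx
    have hy' := hg_div y hy
    rw [Nat.ModEq, Nat.mod_eq_of_lt (by omega), Nat.mod_eq_of_lt (by omega)] at hdiv
    exact hg_inj x hx y hy (Nat.eq_of_div_eq_of_add_mod_eq 0 (by omega) hp)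
  · refine (card_le_card_of_injOn (fun x => g x / k) (t := range c) ?_ ?_).trans_eq (card_range c)
    · intro x hx
      simpa using hg_div x (mem_filter.1 hx).1
    · intro x hx y hy h
      rw [mem_coe, mem_filter] at hx hy
      have hmod := Fin.val_eq_of_eq (hx.2.trans hy.2.symm)
      exact hg_inj x hx.1 y hy.1 (Nat.eq_of_div_eq_of_add_mod_eq 0 h hmod)
  · refine (card_le_card_of_injOn (fun x => g x / k) (t := range c) ?_ ?_).trans_eq (card_range c)
    · intro x hx
      simpa using hg_div x (mem_filter.1 hx).1
    · intro x hx y hy h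
      rw [mem_coe, mem_filter] at hx hy
      have hmod := Fin.val_eq_of_eq (hx.2.trans hy.2.symm)
      replace h : g x / k = g y / k := h
      simp only [h] at hmod
      exact hg_inj x hx.1 y hy.1 (Nat.eq_of_div_eq_of_add_mod_eq _ h hmod)

open Finset in
/-- If `k * m` exceeds `#X` by `D ≤ k * c`, then `X` is covered by `k` sets of size `m` such that
no point lies in three of them and any two of them share at most two points. -/
theorem exists_cover_of_card_add_eq {α : Type*} [DecidableEq α] (X : Finset α) {k m c D : ℕ}
    (hk : 0 < k) (hck : c < k) (hD : D ≤ k * c) (hDX : D ≤ #X) (hcm : 2 * c ≤ m)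
    (hsum : #X + D = k * m) :
    ∃ Y : Fin k → Finset α,
      (∀ i, Y i ⊆ X) ∧
      (∀ i, #(Y i) = m) ∧
      (∀ i j l, i ≠ j → j ≠ l → i ≠ l → Y i ∩ Y j ∩ Y l = ∅) ∧
      univ.biUnion Y = X ∧
      (∀ i j, i ≠ j → #(Y i ∩ Y j) ≤ 2) := by
  obtain ⟨S, hSX, rfl⟩ := exists_subset_card_eq hDX
  obtain ⟨p, q, hpq, hinj, hp, hq⟩ := exists_balanced_pair_labels S hk hck hD
  have : Nonempty (Fin k) := ⟨⟨0, hk⟩⟩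
  have hle (i : Fin k) : #{x ∈ S | p x = i} + #{x ∈ S | q x = i} ≤ m := by
    have := hp i
    have := hq i
    omega
  have hfiber (r : α → Fin k) : ∑ i, #{x ∈ S | r x = i} = #S :=
    (card_eq_sum_card_fiberwise fun _ _ => mem_univ _).symm
  obtain ⟨f, hf⟩ := exists_label_card_fiber_eq (X \ S)
    (fun i => m - (#{x ∈ S | p x = i} + #{x ∈ S | q x = i})) (by
      rw [sum_tsub_distrib _ fun i _ => hle i, sum_add_distrib, hfiber, hfiber,
        card_sdiff_of_subset hSX]
      simp only [sum_const, card_univ, Fintype.card_fin, smul_eq_mul]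
      omega)
  let P : α → Fin k := fun x => if x ∈ S then p x else f x
  let Q : α → Fin k := fun x => if x ∈ S then q x else f x
  have hmem {i j : Fin k} (hij : i ≠ j) {x : α} (hi : P x = i ∨ Q x = i) (hj : P x = j ∨ Q x = j) :
      x ∈ S ∧ (p x = i ∧ q x = j ∨ p x = j ∧ q x = i) := by
    by_cases hx : x ∈ S
    · simp only [P, Q, hx, if_true] at hi hj
      grind
    · simp only [P, Q, hx, if_false] at hi hj
      grind
  have hpair (i j : Fin k) : #{x ∈ S | p x = i ∧ q x = j} ≤ 1 := by
    rw [card_le_one]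
    intro x hx y hy
    rw [mem_filter] at hx hy
    exact hinj x hx.1 y hy.1 (hx.2.1.trans hy.2.1.symm) (hx.2.2.trans hy.2.2.symm)
  refine ⟨fun i => {x ∈ X | P x = i ∨ Q x = i}, fun i => filter_subset _ _, fun i => ?_,
    fun i j l hij hjl hil => ?_, ?_, fun i j hij => ?_⟩
  · have hdecomp : {x ∈ X | P x = i ∨ Q x = i} =
        ({x ∈ S | p x = i} ∪ {x ∈ S | q x = i}) ∪ {x ∈ X \ S | f x = i} := by
      ext x
      have := @hSX x
      simp only [P, Q, mem_filter, mem_union, mem_sdiff]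
      grind
    have hdisj : Disjoint {x ∈ S | p x = i} {x ∈ S | q x = i} :=
      disjoint_filter.2 fun x hx hpx hqx => hpq x hx (hpx.trans hqx.symm)
    have hdisj' : Disjoint ({x ∈ S | p x = i} ∪ {x ∈ S | q x = i}) {x ∈ X \ S | f x = i} :=
      disjoint_left.2 fun x hx hx' => by
        simp only [mem_filter, mem_union, mem_sdiff] at hx hx'
        tauto
    beta_reduce
    rw [hdecomp, card_union_of_disjoint hdisj', card_union_of_disjoint hdisj, hf]
    exact Nat.add_sub_cancel' (hle i)
  · refine eq_empty_of_forall_notMem fun x hx => ?_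
    simp only [mem_inter, mem_filter] at hx
    obtain ⟨⟨⟨_, hi⟩, _, hj⟩, _, hl⟩ := hx
    grind
  · ext x
    simp
  · have hsub : {x ∈ X | P x = i ∨ Q x = i} ∩ {x ∈ X | P x = j ∨ Q x = j} ⊆
        {x ∈ S | p x = i ∧ q x = j} ∪ {x ∈ S | p x = j ∧ q x = i} := fun x hx => by
      simp only [mem_inter, mem_filter] at hx
      simp only [mem_union, mem_filter]
      have := hmem hij hx.1.2 hx.2.2
      tauto
    refine (card_le_card hsub).trans ((card_union_le _ _).trans ?_)
    have := hpair i j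
    have := hpair j i
    omega

/-- **Combinatorial covering lemma (part 1).**
Let `X` have `n` elements, `a < n`, `k > 2`, `n ≥ k²` and
`(k-1)(n-k) ≤ k·a ≤ (k-1)·n`. Then there are subsets `Y₁, …, Y_k` of `X`,
each of size `n - a`, any three of which (with pairwise distinct indices) have
empty intersection, whose union is `X`, and any two of which meet in at most
two elements. -/
theorem covering_sets_exists {α : Type*} [DecidableEq α]
    (X : Finset α) (n a k : ℕ) (hX : X.card = n)
    (han : a < n) (hk : 2 < k) (hnk : k ^ 2 ≤ n)
    (h1 : (k - 1) * (n - k) ≤ k * a) (h2 : k * a ≤ (k - 1) * n) :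
    ∃ Y : Fin k → Finset α,
      (∀ i, Y i ⊆ X) ∧
      (∀ i, (Y i).card = n - a) ∧
      (∀ i j l, i ≠ j → j ≠ l → i ≠ l → Y i ∩ Y j ∩ Y l = ∅) ∧
      Finset.univ.biUnion Y = X ∧
      (∀ i j, i ≠ j → (Y i ∩ Y j).card ≤ 2) := by
  subst hX
  obtain ⟨m, hm⟩ := Nat.exists_eq_add_of_le han.le
  obtain ⟨b, rfl⟩ := Nat.exists_eq_add_of_le' (show 1 ≤ k by omega)
  obtain ⟨r, hr⟩ := Nat.exists_eq_add_of_le (show b + 1 ≤ X.card by nlinarith)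
  rw [Nat.add_sub_cancel] at h1 h2
  rw [show X.card - (b + 1) = r by omega] at h1
  have hlower : X.card ≤ (b + 1) * m := by nlinarith
  have hupper : (b + 1) * m ≤ X.card + (b + 1) * b := by nlinarith
  have hbm : b + 1 ≤ m := by nlinarith
  obtain ⟨s, rfl⟩ := Nat.exists_eq_add_of_le hbm
  have hexcess : (b + 1) * (b + 1 + s) - X.card ≤ (b + 1) * min b s := by
    rcases min_choice b s with h | h <;> rw [h, Nat.sub_le_iff_le_add] <;> nlinarith
  rw [show X.card - a = b + 1 + s by omega]
  refine exists_cover_of_card_add_eq X (Nat.succ_pos b) (by omega) hexcess ?_ (by omega)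
    (Nat.add_sub_cancel' hlower)
  rw [Nat.sub_le_iff_le_add]
  nlinarith
end

section
/- Let $X$ be a finite set with $n$ elements and let $b > c$ be natural numbers such that $c\, n > b\,(b + c)$. Then there exist a natural number $k$ and subsets $Y_1, \ldots, Y_k$ of $X$ such that $|Y_i| = b$ for all $i \le k$, $\bigcup_{i=1}^{k} Y_i = X$, and $|Y_i \cap Y_j| \le c + 1$ whenever $i \ne j$. -/
open Finset

/-- Consecutive blocks of length `b`, together with one more set made of the remainder and of
at most `c` elements of each block, cover `range n`. -/
theorem exists_cover_range {n b c : ℕ} (hbc : c < b) (h : b * (b + c) < c * n) :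
    ∃ (k : ℕ) (Y : Fin k → Finset ℕ),
      (∀ i, Y i ⊆ range n) ∧ (∀ i, (Y i).card = b) ∧ univ.biUnion Y = range n ∧
      (∀ i j, i ≠ j → (Y i ∩ Y j).card ≤ c) := by
  obtain ⟨q, r, hr, rfl⟩ : ∃ q r, r < b ∧ n = q * b + r :=
    ⟨n / b, n % b, Nat.mod_lt _ (by omega), (Nat.div_add_mod' n b).symm⟩
  have hq : b ≤ q * c := by
    by_contra! hlt
    nlinarith
  -- the initial segments of length `c` of the blocks
  set S : Finset ℕ := (range q).biUnion fun i => Ico (i * b) (i * b + c) with hS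
  have block_disj : ∀ {i j x : ℕ}, i * b ≤ x → x < i * b + b → j * b ≤ x → x < j * b + b →
      i = j := by
    intro i j x h1 h2 h3 h4
    by_contra hne
    rcases Nat.lt_or_gt_of_ne hne with hlt | hlt <;> nlinarith
  have hSmem : ∀ {x}, x ∈ S → ∃ i < q, i * b ≤ x ∧ x < i * b + c := by
    intro x hx
    simpa [hS] using hx
  have hScard : S.card = q * c := by
    rw [hS, card_biUnion]
    · simp
    · intro i _ j _ hij
      rw [Function.onFun, disjoint_left]
      intro x hx hx'
      rw [mem_Ico] at hx hx'
      exact hij (block_disj hx.1 (by omega) hx'.1 (by omega))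
  have hSlt : ∀ {x}, x ∈ S → x < q * b := by
    intro x hx
    obtain ⟨i, hi, -, h2⟩ := hSmem hx
    nlinarith
  obtain ⟨T, hTS, hT⟩ := exists_subset_card_eq (s := S) (n := b - r) (by omega)
  set L : Finset ℕ := Ico (q * b) (q * b + r) ∪ T with hL
  have hLcard : L.card = b := by
    rw [hL, card_union_of_disjoint, hT, Nat.card_Ico]
    · omega
    · rw [disjoint_left]
      intro x hx hx'
      have := hSlt (hTS hx')
      rw [mem_Ico] at hx
      omega
  have hLsub : L ⊆ range (q * b + r) := by
    intro x hx
    rw [mem_range]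
    rcases mem_union.1 hx with hx | hx
    · exact (mem_Ico.1 hx).2
    · have := hSlt (hTS hx)
      omega
  have hBsub : ∀ i < q, Ico (i * b) (i * b + b) ⊆ range (q * b + r) := by
    intro i hi x hx
    rw [mem_Ico] at hx
    rw [mem_range]
    nlinarith
  have hBL : ∀ i < q, (Ico (i * b) (i * b + b) ∩ L).card ≤ c := by
    intro i hi
    have hsub : Ico (i * b) (i * b + b) ∩ L ⊆ Ico (i * b) (i * b + c) := by
      intro x hx
      obtain ⟨hx1, hx2⟩ := mem_inter.1 hx
      rw [mem_Ico] at hx1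
      rcases mem_union.1 hx2 with hx2 | hx2
      · rw [mem_Ico] at hx2
        nlinarith
      · obtain ⟨j, hj, h1, h2⟩ := hSmem (hTS hx2)
        obtain rfl := block_disj hx1.1 hx1.2 h1 (by omega)
        exact mem_Ico.2 ⟨h1, h2⟩
    simpa using card_le_card hsub
  let Y : Fin (q + 1) → Finset ℕ :=
    fun i => if (i : ℕ) < q then Ico ((i : ℕ) * b) ((i : ℕ) * b + b) else L
  have hYsub : ∀ i, Y i ⊆ range (q * b + r) := by
    intro i
    by_cases hi : (i : ℕ) < q
    · simpa only [Y, if_pos hi] using hBsub i hi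
    · simpa only [Y, if_neg hi] using hLsub
  refine ⟨q + 1, Y, hYsub, ?_, ?_, ?_⟩
  · intro i
    by_cases hi : (i : ℕ) < q <;> simp [Y, hi, hLcard]
  · refine Subset.antisymm (biUnion_subset.2 fun i _ => hYsub i) fun x hx => ?_
    rw [mem_range] at hx
    by_cases hxq : x < q * b
    · have hdiv : x / b < q := (Nat.div_lt_iff_lt_mul (by omega)).2 hxq
      refine mem_biUnion.2 ⟨⟨x / b, by omega⟩, mem_univ _, ?_⟩
      simp only [Y, if_pos hdiv, mem_Ico]
      have h1 := Nat.div_add_mod' x b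
      have h2 : x % b < b := Nat.mod_lt _ (by omega)
      omega
    · refine mem_biUnion.2 ⟨Fin.last q, mem_univ _, ?_⟩
      have hxL : x ∈ L := mem_union_left _ (mem_Ico.2 ⟨by omega, hx⟩)
      simpa [Y] using hxL
  · intro i j hij
    have hne : (i : ℕ) ≠ j := fun hval => hij (Fin.ext hval)
    by_cases hi : (i : ℕ) < q <;> by_cases hj : (j : ℕ) < q
    · simp only [Y, if_pos hi, if_pos hj]
      rw [disjoint_iff_inter_eq_empty.1, card_empty]
      · exact Nat.zero_le c
      · rw [disjoint_left]
        intro x hx hx'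
        rw [mem_Ico] at hx hx'
        exact hne (block_disj hx.1 hx.2 hx'.1 hx'.2)
    · simpa only [Y, if_pos hi, if_neg hj] using hBL i hi
    · simpa only [Y, if_pos hj, if_neg hi, inter_comm] using hBL j hj
    · omega

/-- **Combinatorial covering lemma (part 2).**
Let `X` have `n` elements and let `b > c` be naturals with `c·n > b·(b+c)`.
Then for some `k` there are subsets `Y₁, …, Y_k` of `X`, each of size `b`,
whose union is `X`, and any two of which meet in at most `c + 1` elements. -/
theorem covering_sets_exists' {α : Type*} [DecidableEq α]
    (X : Finset α) (n b c : ℕ) (hX : X.card = n)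
    (hbc : c < b) (h : b * (b + c) < c * n) :
    ∃ (k : ℕ) (Y : Fin k → Finset α),
      (∀ i, Y i ⊆ X) ∧
      (∀ i, (Y i).card = b) ∧
      Finset.univ.biUnion Y = X ∧
      (∀ i j, i ≠ j → (Y i ∩ Y j).card ≤ c + 1) := by
  obtain ⟨k, Y, hsub, hcard, hunion, hinter⟩ := exists_cover_range hbc h
  obtain ⟨g, hg, hgX⟩ : ∃ g : ℕ → α, Set.InjOn g (range n) ∧ (range n).image g = X := by
    have hn : 0 < n := Nat.pos_of_ne_zero fun h0 => by simp [h0] at h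
    have hne : X.Nonempty := card_pos.1 (hX ▸ hn)
    have : Nonempty α := ⟨hne.choose⟩
    obtain ⟨g, hg⟩ := (range n).finite_toSet.exists_bijOn_of_encard_eq (t := (X : Set α))
      (by simp only [Set.encard_coe_eq_coe_finsetCard, card_range, hX])
    exact ⟨g, hg.injOn, coe_injective (by rw [coe_image, hg.image_eq])⟩
  have hinj : ∀ i, Set.InjOn g (Y i) := fun i => hg.mono (coe_subset.2 (hsub i))
  refine ⟨k, fun i => (Y i).image g, fun i => hgX ▸ image_subset_image (hsub i), fun i => ?_, ?_,
    fun i j hij => ?_⟩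
  · rw [card_image_of_injOn (hinj i), hcard]
  · rw [← hgX, ← hunion, biUnion_image]
  · rw [← image_inter_of_injOn _ _ (hg.mono (by
      rw [← coe_union]
      exact coe_subset.2 (union_subset (hsub i) (hsub j))))]
    exact card_image_le.trans ((hinter i j hij).trans (Nat.le_succ c))
end
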